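/- Let G be (⌊3f/2⌋+1)-connected with minimum degree at least 2f, F a vertex set with |F| ≤ f, and Z, N a partition of V(G). For any vertex v, define (A,B) by: if |Z∩F| ≤ ⌊f/2⌋ and |N| > f then (A,B)=(N,Z); if |Z∩F| ≤ ⌊f/2⌋ and |N| ≤ f then (A,B)=(Z,N); if |Z∩F| > ⌊f/2⌋ and |Z| > f then (A,B)=(Z,N); otherwise (A,B)=(N,Z). Then if v ∈ B, there exist f+1 pairwise internally disjoint paths from distinct vertices of A to v whose internal vertices all avoid F. -/

import Mathlib

open Finset

/-- Internal vertices of a walk: all vertices of its support except the endpoints. -/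
def SimpleGraph.Walk.internals {V : Type*} {G : SimpleGraph V} {u v : V}
    (p : G.Walk u v) : List V :=
  p.support.tail.dropLast

/-- A graph is `k`-connected if it has more than `k` vertices and removing any set
of at most `k` vertices leaves it connected. -/
def KConnected {V : Type*} [DecidableEq V] (G : SimpleGraph V) (k : ℕ) : Prop :=
  k < Nat.card V ∧
    ∀ S : Finset V, S.card ≤ k → (((⊤ : G.Subgraph).deleteVerts ↑S).coe).Connected

/-- `DiPath r a b s`: there is a simple directed path from `a` to `b` along `r` whose set of
vertices is `s`. -/
inductive DiPath {V : Type*} (r : V → V → Prop) : V → V → Set V → Prop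
  | nil (a : V) : DiPath r a a {a}
  | cons {a c b : V} {s : Set V} (h : r a c) (ha : a ∉ s) (p : DiPath r c b s) :
      DiPath r a b (insert a s)

namespace DiPath

variable {V : Type*} {r r' : V → V → Prop} {a b c : V} {s t : Set V}

theorem start_mem (p : DiPath r a b s) : a ∈ s := by
  cases p <;> simp

theorem end_mem (p : DiPath r a b s) : b ∈ s := by
  induction p with
  | nil a => simp
  | cons h ha p ih => exact Or.inr ih

theorem trans (p : DiPath r a b s) (q : DiPath r b c t) (h : ∀ u ∈ s, u ∈ t → u = b) :
    DiPath r a c (s ∪ t) := by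
  induction p with
  | nil a =>
    have : ({a} : Set V) ∪ t = t := by
      simpa using q.start_mem
    rwa [this]
  | @cons a d b s had ha p ih =>
    rw [Set.insert_union]
    refine cons had ?_ (ih q fun u hu => h u (Or.inr hu))
    rintro (h' | h')
    · exact ha h'
    · exact ha (h a (Or.inl rfl) h' ▸ p.end_mem)

theorem split (p : DiPath r a b s) {u : V} (hu : u ∈ s) :
    ∃ s₁ s₂, DiPath r a u s₁ ∧ DiPath r u b s₂ ∧ s₁ ⊆ s ∧ s₂ ⊆ s ∧
      ∀ w ∈ s₁, w ∈ s₂ → w = u := by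
  induction p with
  | nil a =>
    obtain rfl : u = a := hu
    exact ⟨{u}, {u}, nil u, nil u, subset_rfl, subset_rfl, fun w hw _ => hw⟩
  | @cons a d b s had ha p ih =>
    by_cases hua : u = a
    · subst hua
      exact ⟨{u}, insert u s, nil u, cons had ha p, by simp, subset_rfl, fun w hw _ => hw⟩
    · obtain ⟨s₁, s₂, p₁, p₂, h₁, h₂, h⟩ := ih (hu.resolve_left hua)
      refine ⟨insert a s₁, s₂, cons had (fun h' => ha (h₁ h')) p₁, p₂,
        Set.insert_subset_insert h₁, h₂.trans (Set.subset_insert _ _), ?_⟩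
      rintro w (rfl | hw) hw₂
      · exact absurd (h₂ hw₂) ha
      · exact h w hw hw₂

theorem mono (p : DiPath r a b s)
    (h : ∀ u ∈ s, ∀ w ∈ s, u ≠ b → w ≠ a → r u w → r' u w) : DiPath r' a b s := by
  induction p with
  | nil a => exact nil a
  | @cons a d b s had ha p ih =>
    refine cons (h a (Or.inl rfl) d (Or.inr p.start_mem) ?_ ?_ had) ha
      (ih fun u hu w hw hub _ => h u (Or.inr hu) w (Or.inr hw) hub ?_)
    · rintro rfl; exact ha p.end_mem
    · rintro rfl; exact ha p.start_mem
    · rintro rfl; exact ha hw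

theorem exists_first (p : DiPath r a b s) {P : Set V} (h : ∃ u ∈ P, u ∈ s) :
    ∃ u ∈ P, ∃ s₁ ⊆ s, DiPath r a u s₁ ∧ ∀ w ∈ s₁, w ∈ P → w = u := by
  induction p with
  | nil a =>
    obtain ⟨u, hu, rfl⟩ := h
    exact ⟨u, hu, {u}, subset_rfl, nil u, fun w hw _ => hw⟩
  | @cons a d b s had ha p ih =>
    by_cases haP : a ∈ P
    · exact ⟨a, haP, {a}, by simp, nil a, fun w hw _ => hw⟩
    · obtain ⟨u, hu, hus⟩ := h
      obtain ⟨u, hu, s₁, h₁, p₁, h⟩ :=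
        ih ⟨u, hu, hus.resolve_left (by rintro rfl; exact haP hu)⟩
      refine ⟨u, hu, insert a s₁, Set.insert_subset_insert h₁,
        cons had (fun h' => ha (h₁ h')) p₁, ?_⟩
      rintro w (rfl | hw) hwP
      · exact absurd hwP haP
      · exact h w hw hwP

theorem exists_last (p : DiPath r a b s) {P : Set V} (h : ∃ u ∈ P, u ∈ s) :
    ∃ u ∈ P, ∃ s₁ ⊆ s, DiPath r u b s₁ ∧ ∀ w ∈ s₁, w ∈ P → w = u := by
  induction p with
  | nil a =>
    obtain ⟨u, hu, rfl⟩ := h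
    exact ⟨u, hu, {u}, subset_rfl, nil u, fun w hw _ => hw⟩
  | @cons a d b s had ha p ih =>
    by_cases hs : ∃ u ∈ P, u ∈ s
    · obtain ⟨u, hu, s₁, h₁, p₁, h⟩ := ih hs
      exact ⟨u, hu, s₁, h₁.trans (Set.subset_insert _ _), p₁, h⟩
    · obtain ⟨u, hu, hus⟩ := h
      obtain rfl : u = a := hus.resolve_right fun h' => hs ⟨u, hu, h'⟩
      refine ⟨u, hu, _, subset_rfl, cons had ha p, ?_⟩
      rintro w (rfl | hw) hwP
      · rfl
      · exact absurd ⟨w, hwP, hw⟩ hs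

theorem eq_start_or_exists_rel (p : DiPath r a b s) {u : V} (hu : u ∈ s) :
    u = a ∨ ∃ w, r w u := by
  induction p with
  | nil a => exact Or.inl hu
  | @cons a d b s had ha p ih =>
    rcases hu with rfl | hu
    · exact Or.inl rfl
    · rcases ih hu with rfl | h
      · exact Or.inr ⟨a, had⟩
      · exact Or.inr h

theorem exists_walk {G : SimpleGraph V} (p : DiPath r a b s) (hr : ∀ u w, r u w → G.Adj u w) :
    ∃ q : G.Walk a b, q.IsPath ∧ ∀ u, u ∈ q.support ↔ u ∈ s := by
  induction p with
  | nil a => exact ⟨.nil, by simp, by simp⟩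
  | @cons a d b s had ha p ih =>
    obtain ⟨q, hq, hs⟩ := ih
    refine ⟨.cons (hr _ _ had) q, ?_, fun u => ?_⟩
    · rw [SimpleGraph.Walk.cons_isPath_iff]
      exact ⟨hq, by rwa [hs]⟩
    · simp [hs]

end DiPath

/-- The vertex set `S` meets every directed path along `r` from `A` to `B`. -/
def Separates {V : Type*} (r : V → V → Prop) (A B S : Set V) : Prop :=
  ∀ a ∈ A, ∀ b ∈ B, ∀ s, DiPath r a b s → ∃ u ∈ S, u ∈ s

/-- `a`, `b` and `s` describe a family of `k` pairwise disjoint directed paths from `A` to `B`. -/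
structure IsLinkage {V : Type*} (r : V → V → Prop) (A B : Set V) {k : ℕ}
    (a b : Fin k → V) (s : Fin k → Set V) : Prop where
  start_mem : ∀ i, a i ∈ A
  end_mem : ∀ i, b i ∈ B
  diPath : ∀ i, DiPath r (a i) (b i) (s i)
  eq_of_mem : ∀ i j u, u ∈ s i → u ∈ s j → i = j

namespace IsLinkage

variable {V : Type*} {r : V → V → Prop} {k : ℕ} {a b : Fin k → V} {s : Fin k → Set V}

theorem start_injective {A B : Set V} (L : IsLinkage r A B a b s) : Function.Injective a :=
  fun i j h => L.eq_of_mem i j (a i) (L.diPath i).start_mem (h ▸ (L.diPath j).start_mem)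

theorem end_injective {A B : Set V} (L : IsLinkage r A B a b s) : Function.Injective b :=
  fun i j h => L.eq_of_mem i j (b i) (L.diPath i).end_mem (h ▸ (L.diPath j).end_mem)

theorem exists_start_eq {A : Finset V} {B : Set V} (L : IsLinkage r A B a b s) (hA : A.card = k)
    {u : V} (hu : u ∈ A) : ∃ i, a i = u := by
  classical
  have h : univ.image a = A := eq_of_subset_of_card_le
    (by simpa [Finset.subset_iff] using L.start_mem)
    (by rw [card_image_of_injective _ L.start_injective]; simp [hA])
  simpa [← h] using hu

theorem exists_end_eq {A : Set V} {B : Finset V} (L : IsLinkage r A B a b s) (hB : B.card = k)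
    {u : V} (hu : u ∈ B) : ∃ i, b i = u := by
  classical
  have h : univ.image b = B := eq_of_subset_of_card_le
    (by simpa [Finset.subset_iff] using L.end_mem)
    (by rw [card_image_of_injective _ L.end_injective]; simp [hB])
  simpa [← h] using hu

theorem eq_start {A : Finset V} {B : Set V} (L : IsLinkage r A B a b s) (hA : A.card = k)
    {u : V} (hu : u ∈ A) {i : Fin k} (hi : u ∈ s i) : u = a i := by
  obtain ⟨j, rfl⟩ := L.exists_start_eq hA hu
  rw [L.eq_of_mem i j _ hi (L.diPath j).start_mem]

theorem eq_end {A : Set V} {B : Finset V} (L : IsLinkage r A B a b s) (hB : B.card = k)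
    {u : V} (hu : u ∈ B) {i : Fin k} (hi : u ∈ s i) : u = b i := by
  obtain ⟨j, rfl⟩ := L.exists_end_eq hB hu
  rw [L.eq_of_mem i j _ hi (L.diPath j).end_mem]

end IsLinkage

/-- **Menger's theorem** for finite directed graphs, in its vertex version between two sets. -/
theorem menger {V : Type*} [DecidableEq V] (E : Finset (V × V)) (A B : Finset V) (k : ℕ)
    (h : ∀ S : Finset V, Separates (fun u w => (u, w) ∈ E) A B S → k ≤ S.card) :
    ∃ (a b : Fin k → V) (s : Fin k → Set V),
      IsLinkage (fun u w => (u, w) ∈ E) A B a b s := by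
  induction E using Finset.induction_on generalizing A B with
  | empty =>
    have hk : k ≤ (A ∩ B).card := by
      apply h
      rintro a ha b hb s p
      cases p with
      | nil => exact ⟨a, by simpa using ⟨ha, hb⟩, rfl⟩
      | cons h => simp at h
    obtain ⟨T, hT, rfl⟩ := exists_subset_card_eq hk
    have hmem (i) : (T.equivFin.symm i : V) ∈ A ∩ B := hT (T.equivFin.symm i).2
    refine ⟨fun i => T.equivFin.symm i, fun i => T.equivFin.symm i,
      fun i => {(T.equivFin.symm i : V)}, fun i => ?_, fun i => ?_, fun i => .nil _, ?_⟩
    · exact (mem_inter.1 (hmem i)).1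
    · exact (mem_inter.1 (hmem i)).2
    · intro i j u hi hj
      have h' : (T.equivFin.symm i : V) = T.equivFin.symm j := hi.symm.trans hj
      simpa using h'
  | insert e E he ih =>
    obtain ⟨x, y⟩ := e
    by_cases hE : ∀ S : Finset V, Separates (fun u w => (u, w) ∈ E) A B S → k ≤ S.card
    · obtain ⟨a, b, s, L⟩ := ih A B hE
      exact ⟨a, b, s, L.start_mem, L.end_mem,
        fun i => (L.diPath i).mono fun _ _ _ _ _ _ => mem_insert_of_mem, L.eq_of_mem⟩
    push Not at hE
    obtain ⟨S, hS, hSk⟩ := hE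
    have hsep (z : V) (hz : z = x ∨ z = y) :
        Separates (fun u w => (u, w) ∈ insert (x, y) E) A B ↑(insert z S) := by
      intro a ha b hb s p
      by_cases hzs : z ∈ s
      · exact ⟨z, by simp, hzs⟩
      · obtain ⟨u, hu, hus⟩ := hS a ha b hb s (p.mono fun u hu w hw _ _ huw => by
          rcases mem_insert.1 huw with h' | h'
          · obtain ⟨rfl, rfl⟩ := Prod.mk.inj h'
            rcases hz with rfl | rfl <;> contradiction
          · exact h')
        exact ⟨u, by simpa using Or.inr hu, hus⟩
    have hcard (z : V) (hz : z = x ∨ z = y) : (insert z S).card = k :=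
      le_antisymm ((card_insert_le _ _).trans hSk) (h _ (hsep z hz))
    have hP := hcard x (.inl rfl)
    have hQ := hcard y (.inr rfl)
    have hxS : x ∉ S := fun h' => by rw [insert_eq_of_mem h'] at hP; omega
    have hyS : y ∉ S := fun h' => by rw [insert_eq_of_mem h'] at hQ; omega
    obtain ⟨a, p, s, L⟩ := ih A (insert x S) fun T hT => h T fun a ha b hb s q => by
      obtain ⟨u, hu, s₁, h₁, q₁, hu₁⟩ := q.exists_first (hsep x (.inl rfl) a ha b hb s q)
      obtain ⟨t, ht, hts⟩ := hT a ha u hu s₁ (q₁.mono fun v hv w hw hvu _ hvw => by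
        rcases mem_insert.1 hvw with h' | h'
        · obtain ⟨rfl, rfl⟩ := Prod.mk.inj h'
          exact absurd (hu₁ v hv (by simp)) hvu
        · exact h')
      exact ⟨t, ht, h₁ hts⟩
    obtain ⟨q, b, t, M⟩ := ih (insert y S) B fun T hT => h T fun a ha b hb s q => by
      obtain ⟨u, hu, s₁, h₁, q₁, hu₁⟩ := q.exists_last (hsep y (.inr rfl) a ha b hb s q)
      obtain ⟨t, ht, hts⟩ := hT u hu b hb s₁ (q₁.mono fun v hv w hw _ hwu hvw => by
        rcases mem_insert.1 hvw with h' | h'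
        · obtain ⟨rfl, rfl⟩ := Prod.mk.inj h'
          exact absurd (hu₁ w hw (by simp)) hwu
        · exact h')
      exact ⟨t, ht, h₁ hts⟩
    have hmeet (i j u) (hi : u ∈ s i) (hj : u ∈ t j) : u ∈ S ∧ u = p i ∧ u = q j := by
      obtain ⟨s₁, s₂, α₁, α₂, hs₁, -, hs⟩ := (L.diPath i).split hi
      obtain ⟨t₁, t₂, β₁, β₂, -, ht₂, ht⟩ := (M.diPath j).split hj
      by_cases huS : u ∈ S
      · exact ⟨huS, L.eq_end hP (mem_insert_of_mem huS) hi,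
          M.eq_start hQ (mem_insert_of_mem huS) hj⟩
      exfalso
      have key₁ : ∀ w ∈ s₁, w ∉ S := fun w hw hwS => huS <| by
        have := L.eq_end hP (mem_insert_of_mem hwS) (hs₁ hw)
        rwa [← hs w hw (this ▸ α₂.end_mem)]
      have key₂ : ∀ w ∈ t₂, w ∉ S := fun w hw hwS => huS <| by
        have := M.eq_start hQ (mem_insert_of_mem hwS) (ht₂ hw)
        rwa [← ht w (this ▸ β₁.start_mem) hw]
      obtain ⟨w, hwP, s', hs', γ, hw⟩ := α₁.exists_first (P := t₂) ⟨u, β₂.start_mem, α₁.end_mem⟩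
      obtain ⟨t₃, t₄, -, γ', -, ht₄, -⟩ := β₂.split hwP
      obtain ⟨z, hzS, hz⟩ := hS _ (L.start_mem i) _ (M.end_mem j) _
        (γ.trans γ' fun z hz hz' => hw z hz (ht₄ hz'))
      rcases hz with hz | hz
      · exact key₁ z (hs' hz) hzS
      · exact key₂ z (ht₄ hz) hzS
    have hpQ (i) : (if p i = x then y else p i) ∈ insert y S := by
      have := L.end_mem i
      split_ifs with hi
      · simp
      · simp only [coe_insert, Set.mem_insert_iff, hi, false_or, mem_coe] at this
        exact mem_insert_of_mem this
    choose j hj using fun i => M.exists_start_eq hQ (hpQ i)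
    have hj_inj : Function.Injective j := fun i i' hii => by
      have h₁ := hj i
      rw [hii, hj i'] at h₁
      have hi := L.end_mem i
      have hi' := L.end_mem i'
      apply L.end_injective
      simp only [coe_insert, Set.mem_insert_iff, mem_coe] at hi hi'
      grind
    have hq (i i' u) (hi : u ∈ s i) (hi' : u ∈ t (j i')) : i = i' := by
      obtain ⟨huS, hup, huq⟩ := hmeet i _ u hi hi'
      apply L.end_injective
      have := hj i'
      grind
    refine ⟨a, fun i => b (j i), fun i => s i ∪ t (j i), L.start_mem, fun i => M.end_mem _,
      fun i => ?_, ?_⟩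
    · have hα : DiPath (fun u w => (u, w) ∈ insert (x, y) E) (a i) (p i) (s i) :=
        (L.diPath i).mono fun _ _ _ _ _ _ => mem_insert_of_mem
      have hβ : DiPath (fun u w => (u, w) ∈ insert (x, y) E) (q (j i)) (b (j i)) (t (j i)) :=
        (M.diPath _).mono fun _ _ _ _ _ _ => mem_insert_of_mem
      have hji := hj i
      split_ifs at hji with hi
      · have hxt : p i ∉ t (j i) := fun h' =>
          hxS (hi ▸ (hmeet i _ (p i) hα.end_mem h').1)
        have := hα.trans (.cons (by simp [hi, hji]) hxt hβ) fun u hu hu' => by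
          rcases hu' with rfl | hu'
          · rfl
          · exact (hmeet i _ u hu hu').2.1
        rwa [Set.union_insert, Set.insert_eq_of_mem (Set.mem_union_left _ hα.end_mem)] at this
      · rw [hji] at hβ
        exact hα.trans hβ fun u hu hu' => (hmeet i _ u hu hu').2.1
    · rintro i i' u (hi | hi) (hi' | hi')
      · exact L.eq_of_mem _ _ u hi hi'
      · exact hq i i' u hi hi'
      · exact (hq i' i u hi' hi).symm
      · exact hj_inj (M.eq_of_mem _ _ u hi hi')

theorem SimpleGraph.Walk.internals_concat {V : Type*} {G : SimpleGraph V} {u v w : V}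
    (p : G.Walk u v) (h : G.Adj v w) : (p.concat h).internals = p.support.tail := by
  cases p <;> simp [SimpleGraph.Walk.internals, SimpleGraph.Walk.support_concat]

/-- If deleting fewer than `D.card + k` vertices leaves `G` connected, then a vertex `v ∉ A` is
reached from a set `A` of at least `k` vertices by a fan of `k` paths, whose internal vertices
avoid both `A` and `D`. -/
theorem exists_fan {V : Type*} [Fintype V] [DecidableEq V] (G : SimpleGraph V) (k : ℕ)
    (A D : Finset V) (v : V) (hvA : v ∉ A) (hvD : v ∉ D) (hAD : Disjoint A D) (hA : k ≤ A.card)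
    (hconn : ∀ S : Finset V, S.card < D.card + k →
      (((⊤ : G.Subgraph).deleteVerts ↑S).coe).Connected) :
    ∃ (a : Fin k → V) (P : ∀ i, G.Walk (a i) v),
      Function.Injective a ∧
      (∀ i, a i ∈ A ∧ (P i).IsPath ∧ ∀ x ∈ (P i).internals, x ∉ A ∧ x ∉ D ∧ x ≠ v) ∧
      ∀ i j, i ≠ j → ∀ x, x ∈ (P i).support → x ∈ (P j).support → x = v := by
  classical
  let E : Finset (V × V) := univ.filter fun e =>
    G.Adj e.1 e.2 ∧ e.2 ∉ A ∧ e.2 ∉ D ∧ e.2 ≠ v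
  have hE (u w) : (u, w) ∈ E ↔ G.Adj u w ∧ w ∉ A ∧ w ∉ D ∧ w ≠ v := by simp [E]
  have hmem {a b : V} {s : Set V} (p : DiPath (fun u w => (u, w) ∈ E) a b s) (u : V)
      (hu : u ∈ s) : u = a ∨ (u ∉ A ∧ u ∉ D ∧ u ≠ v) :=
    (p.eq_start_or_exists_rel hu).imp_right fun ⟨w, hw⟩ => ((hE w u).1 hw).2
  have hv {a b : V} {s : Set V} (ha : a ∈ A) (p : DiPath (fun u w => (u, w) ∈ E) a b s) :
      v ∉ s := fun h => by
    rcases hmem p v h with rfl | h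
    · exact hvA ha
    · exact h.2.2 rfl
  obtain ⟨a, b, s, L⟩ := menger E A (univ.filter fun w => G.Adj w v) k fun S hS => by
    by_contra! hSk
    obtain ⟨n, hnA, hnS⟩ := exists_mem_notMem_of_card_lt_card (hSk.trans_le hA)
    have hc := hconn (D ∪ S.erase v) (by
      have := card_union_le D (S.erase v)
      have := card_le_card (erase_subset v S)
      omega)
    obtain ⟨p⟩ := hc.preconnected
      ⟨n, by simpa [hnS] using Finset.disjoint_left.1 hAD hnA⟩ ⟨v, by simp [hvD]⟩
    have key : ∀ u w, (((⊤ : G.Subgraph).deleteVerts ↑(D ∪ S.erase v)).coe).Walk u w →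
        w.1 = v → ∀ a ∈ A, ∀ s, DiPath (fun u w => (u, w) ∈ E) a u.1 s →
        (∀ z ∈ s, z ∉ S) → False := by
      intro u w p
      induction p with
      | nil =>
        intro hu a ha s q _
        exact hv ha q (hu ▸ q.end_mem)
      | @cons u c w huc p ih =>
        intro hw a ha s q hs
        have hadj : G.Adj u.1 c.1 := (SimpleGraph.Subgraph.coe_adj_sub _ _ _ huc)
        have hcm := c.2
        by_cases hcv : c.1 = v
        · obtain ⟨z, hz, hzs⟩ := hS a ha u.1 (by simpa [← hcv] using hadj) s q
          exact hs z hzs hz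
        have hcD : c.1 ∉ D ∧ c.1 ∉ S := by simpa [hcv] using hcm
        by_cases hcA : c.1 ∈ A
        · exact ih hw c.1 hcA {c.1} (.nil _) (by simpa using hcD.2)
        by_cases hcs : c.1 ∈ s
        · obtain ⟨s₁, -, q₁, -, hs₁, -⟩ := q.split hcs
          exact ih hw a ha s₁ q₁ fun z hz => hs z (hs₁ hz)
        · refine ih hw a ha _ (q.trans (.cons ((hE _ _).2 ⟨hadj, hcA, hcD.1, hcv⟩) ?_ (.nil _))
            ?_) ?_
          · simpa using hadj.ne
          · rintro z hz (rfl | rfl)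
            · rfl
            · contradiction
          · rintro z (hz | rfl | rfl)
            · exact hs z hz
            · exact hs _ q.end_mem
            · exact hcD.2
    exact key _ _ p rfl n hnA {n} (.nil n) (by simpa using hnS)
  choose q hq hqs using fun i => (L.diPath i).exists_walk fun u w h => ((hE u w).1 h).1
  have hb (i) : G.Adj (b i) v := by simpa using L.end_mem i
  refine ⟨a, fun i => (q i).concat (hb i), L.start_injective, fun i => ⟨L.start_mem i, ?_, ?_⟩, ?_⟩
  · exact (hq i).concat (by rw [hqs]; exact hv (L.start_mem i) (L.diPath i)) (hb i)
  · intro x hx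
    rw [SimpleGraph.Walk.internals_concat] at hx
    refine (hmem (L.diPath i) x ((hqs i x).1 (List.mem_of_mem_tail hx))).resolve_left ?_
    rintro rfl
    have := (hq i).support_nodup
    rw [← SimpleGraph.Walk.cons_tail_support, List.nodup_cons] at this
    exact this.1 hx
  · intro i j hij x hi hj
    by_contra hxv
    simp only [SimpleGraph.Walk.support_concat, List.mem_append, hqs,
      List.mem_singleton, hxv, or_false] at hi hj
    exact hij (L.eq_of_mem i j x hi hj)

theorem exists_fan_of_card_inter_le {V : Type*} [Fintype V] [DecidableEq V]
    (G : SimpleGraph V) (f : ℕ) (hconn : KConnected G (3 * f / 2 + 1)) (F A B : Finset V)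
    (hunion : A ∪ B = univ) (hdisj : Disjoint A B) (hBF : (B ∩ F).card ≤ f / 2)
    (hA : f < A.card) (v : V) (hvB : v ∈ B) :
    ∃ (a : Fin (f + 1) → V) (P : ∀ i, G.Walk (a i) v),
      Function.Injective a ∧
      (∀ i, a i ∈ A ∧ (P i).IsPath ∧ ∀ x ∈ (P i).internals, x ∉ F) ∧
      ∀ i j, i ≠ j → ∀ x, x ∈ (P i).support → x ∈ (P j).support → x = v := by
  obtain ⟨a, P, ha, hP, hd⟩ := exists_fan G (f + 1) A ((B ∩ F).erase v) v
    (disjoint_right.1 hdisj hvB) (notMem_erase _ _)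
    (hdisj.mono_right ((erase_subset _ _).trans inter_subset_left)) hA fun S hS => hconn.2 S (by
      have := card_le_card (erase_subset v (B ∩ F))
      omega)
  refine ⟨a, P, ha, fun i => ⟨(hP i).1, (hP i).2.1, fun x hx hxF => ?_⟩, hd⟩
  obtain ⟨hxA, hxD, hxv⟩ := (hP i).2.2 x hx
  have hxB : x ∈ B := (mem_union.1 (hunion ▸ mem_univ x)).resolve_left hxA
  exact hxD (by simp [hxv, hxB, hxF])

theorem exists_fan_of_card_le {V : Type*} [Fintype V] [DecidableEq V]
    (G : SimpleGraph V) (f : ℕ) [DecidableRel G.Adj] (F A B : Finset V)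
    (hunion : A ∪ B = univ) (hB : B.card ≤ f) (v : V) (hvB : v ∈ B)
    (hdeg : 2 * f ≤ G.degree v) :
    ∃ (a : Fin (f + 1) → V) (P : ∀ i, G.Walk (a i) v),
      Function.Injective a ∧
      (∀ i, a i ∈ A ∧ (P i).IsPath ∧ ∀ x ∈ (P i).internals, x ∉ F) ∧
      ∀ i j, i ≠ j → ∀ x, x ∈ (P i).support → x ∈ (P j).support → x = v := by
  have hcard : f + 1 ≤ (G.neighborFinset v \ B.erase v).card := by
    have h₁ := le_card_sdiff (B.erase v) (G.neighborFinset v)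
    have h₂ := card_erase_of_mem hvB
    have h₃ := card_pos.2 ⟨v, hvB⟩
    rw [SimpleGraph.card_neighborFinset_eq_degree] at h₁
    omega
  obtain ⟨T, hT, hTf⟩ := exists_subset_card_eq hcard
  let e := (T.equivFinOfCardEq hTf).symm
  have he (i) : G.Adj v (e i) ∧ (e i : V) ∈ A := by
    have h := hT (e i).2
    simp only [mem_sdiff, SimpleGraph.mem_neighborFinset, mem_erase, not_and] at h
    exact ⟨h.1, (mem_union.1 (hunion ▸ mem_univ _)).resolve_right (h.2 h.1.ne')⟩
  refine ⟨fun i => e i, fun i => (he i).1.symm.toWalk,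
    Subtype.val_injective.comp e.injective, fun i => ⟨(he i).2, ?_, ?_⟩, ?_⟩
  · simpa using (he i).1.ne'
  · simp [SimpleGraph.Walk.internals]
  · intro i j hij x hi hj
    by_contra hxv
    simp only [SimpleGraph.Adj.toWalk, SimpleGraph.Walk.support_cons,
      SimpleGraph.Walk.support_nil, List.mem_cons, hxv, List.not_mem_nil, or_false] at hi hj
    exact hij (e.injective (Subtype.ext (hi.symm.trans hj)))

/-- Propagation lemma (Lemma 4): with `(A, B)` chosen according to the four cases of
step (c) of the algorithm, every node `v ∈ B` has `f+1` internally disjoint paths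
from distinct nodes of `A` whose internal vertices avoid `F`. -/
theorem propagation_lemma {V : Type*} [Fintype V] [DecidableEq V]
    (G : SimpleGraph V) (f : ℕ)
    (hconn : KConnected G (3 * f / 2 + 1))
    [DecidableRel G.Adj] (hdeg : ∀ u : V, 2 * f ≤ G.degree u)
    (F : Finset V) (hF : F.card ≤ f)
    (Z N : Finset V) (hunion : Z ∪ N = Finset.univ) (hdisj : Z ∩ N = ∅)
    (v : V) (A B : Finset V)
    (hAB : (A, B) =
      if (Z ∩ F).card ≤ f / 2 ∧ f < N.card then (N, Z)
      else if (Z ∩ F).card ≤ f / 2 ∧ N.card ≤ f then (Z, N)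
      else if f / 2 < (Z ∩ F).card ∧ f < Z.card then (Z, N)
      else (N, Z))
    (hvB : v ∈ B) :
    ∃ (a : Fin (f + 1) → V) (P : ∀ i, G.Walk (a i) v),
      Function.Injective a ∧
      (∀ i, a i ∈ A ∧ (P i).IsPath ∧ ∀ x ∈ (P i).internals, x ∉ F) ∧
      ∀ i j, i ≠ j → ∀ x, x ∈ (P i).support → x ∈ (P j).support → x = v := by
  have hd : Disjoint Z N := disjoint_iff_inter_eq_empty.2 hdisj
  have hunion' : N ∪ Z = univ := by rwa [union_comm]
  have hNF : f / 2 < (Z ∩ F).card → (N ∩ F).card ≤ f / 2 := fun h => by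
    have h₁ : (Z ∩ F ∪ N ∩ F).card = (Z ∩ F).card + (N ∩ F).card :=
      card_union_of_disjoint (hd.mono inter_subset_left inter_subset_left)
    rw [← union_inter_distrib_right, hunion, univ_inter] at h₁
    omega
  split_ifs at hAB with h₁ h₂ h₃ <;> obtain ⟨rfl, rfl⟩ := Prod.mk.inj hAB
  · exact exists_fan_of_card_inter_le G f hconn F A B hunion' hd.symm h₁.1 h₁.2 v hvB
  · exact exists_fan_of_card_le G f F A B hunion h₂.2 v hvB (hdeg v)
  · exact exists_fan_of_card_inter_le G f hconn F A B hunion hd (hNF h₃.1) h₃.2 v hvB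
  · exact exists_fan_of_card_le G f F A B hunion' (by omega) v hvB (hdeg v)
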